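/- The only positive integers D, b, n, k with k odd satisfying simultaneously D = 2^n·k − 1 and 2^b·D = 3^n·k − 1 are D = b = n = k = 1 (the trivial Collatz cycle 1 → 2 → 1). -/

import Mathlib

open Polynomial

/-! ### Bounded exponents -/

/-- If `2 ^ (n + b)` exceeds `3 ^ n` by less than `2 ^ b`, then `b < n`. -/
theorem lt_of_near_power {n b : ℕ} (hn : 2 ≤ n) (hhi : 2 ^ (n + b) < 3 ^ n + 2 ^ b) : b < n := by
  by_contra! hbn
  have h1 : 2 ^ n ≤ 2 ^ b := Nat.pow_le_pow_right (by norm_num) hbn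
  have h2 : (3 : ℕ) ^ n + 2 ^ n ≤ 4 ^ n := by
    clear hhi hbn h1
    induction n, hn using Nat.le_induction with
    | base => norm_num
    | succ m hm ih =>
      rw [pow_succ, pow_succ, pow_succ]
      omega
  have h3 : (4 : ℕ) ^ n = 2 ^ n * 2 ^ n := by rw [← mul_pow]; norm_num
  rw [pow_add] at hhi
  have h4 : 2 ≤ 2 ^ n := le_trans (by norm_num) (Nat.pow_le_pow_right (show 0 < 2 by norm_num) hn)
  obtain ⟨c, hc⟩ := Nat.exists_eq_add_of_le h1
  obtain ⟨e, he⟩ := Nat.exists_eq_add_of_le h4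
  rw [hc] at hhi
  nlinarith

/-- The linear form `(n + b) log 2 - n log 3` attached to a near coincidence is at most
`2 ^ (1 - n)`. -/
theorem log_form_lt {n b : ℕ} (hn : 1 ≤ n) (hhi : 2 ^ (n + b) < 3 ^ n + 2 ^ b) :
    ((n + b : ℕ) : ℝ) * Real.log 2 - n * Real.log 3 < 2 / 2 ^ n := by
  have hhi' : (2 : ℝ) ^ (n + b) < 3 ^ n + 2 ^ b := by exact_mod_cast hhi
  have h3 : (0 : ℝ) < 3 ^ n := by positivity
  have h2 : (2 : ℝ) ≤ 2 ^ n := by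
    simpa using pow_le_pow_right₀ (show (1 : ℝ) ≤ 2 by norm_num) hn
  have hb : (2 : ℝ) ^ b * 2 ^ n < 2 * 3 ^ n := by
    rw [pow_add] at hhi'
    nlinarith [show (0 : ℝ) < 2 ^ b by positivity]
  calc ((n + b : ℕ) : ℝ) * Real.log 2 - n * Real.log 3
      = Real.log (2 ^ (n + b) / 3 ^ n) := by
        rw [Real.log_div (by positivity) (by positivity), Real.log_pow, Real.log_pow]
    _ ≤ 2 ^ (n + b) / 3 ^ n - 1 := Real.log_le_sub_one_of_pos (by positivity)
    _ < 2 ^ b / 3 ^ n := by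
        rw [div_sub_one (by positivity)]
        gcongr
        linarith
    _ < 2 / 2 ^ n := by
        rw [div_lt_div_iff₀ (by positivity) (by positivity)]
        exact hb

theorem not_near_power_of_lt_sixty :
    ∀ n < 60, 2 ≤ n → ∀ b < n, 3 ^ n < 2 ^ (n + b) → ¬ 2 ^ (n + b) < 3 ^ n + 2 ^ b := by
  decide +kernel

set_option exponentiation.threshold 1000000 in
theorem two_pow_780239_lt : 2 ^ 780239 < 3 ^ 492276 := by
  decide +kernel

set_option exponentiation.threshold 1000000 in
theorem three_pow_190537_mul_lt : 3 ^ 190537 * (2 ^ 24 + 1) < 2 ^ 301994 * 2 ^ 24 := by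
  decide +kernel

set_option exponentiation.threshold 1000000 in
theorem log_three_gt : 780239 * Real.log 2 < 492276 * Real.log 3 := by
  have h : (2 : ℝ) ^ (780239 : ℕ) < 3 ^ (492276 : ℕ) := by exact_mod_cast two_pow_780239_lt
  have := Real.log_lt_log (pow_pos two_pos _) h
  rw [Real.log_pow, Real.log_pow] at this
  exact_mod_cast this

set_option exponentiation.threshold 1000000 in
theorem log_three_lt : 1 / (2 ^ 24 + 1) < 301994 * Real.log 2 - 190537 * Real.log 3 := by
  have h : (3 : ℝ) ^ (190537 : ℕ) * (2 ^ 24 + 1) < 2 ^ (301994 : ℕ) * 2 ^ 24 := by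
    exact_mod_cast three_pow_190537_mul_lt
  have := Real.log_lt_log (mul_pos (pow_pos three_pos _) (by norm_num)) h
  rw [Real.log_mul (pow_pos three_pos _).ne' (by norm_num),
    Real.log_mul (pow_pos two_pos _).ne' (by norm_num), Real.log_pow, Real.log_pow] at this
  have h2 := Real.one_sub_inv_le_log_of_pos (show (0 : ℝ) < (2 ^ 24 + 1) / 2 ^ 24 by norm_num)
  rw [Real.log_div (by norm_num) (by norm_num)] at h2
  norm_num at this h2 ⊢
  linarith

/-- Between the neighbours `780239 / 492276` and `301994 / 190537` of `log 3 / log 2` there is no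
fraction with a small denominator. -/
theorem not_near_power_of_lt {n b : ℕ} (hn : 60 ≤ n) (hn' : n < 682813)
    (hlo : 3 ^ n < 2 ^ (n + b)) : ¬ 2 ^ (n + b) < 3 ^ n + 2 ^ b := by
  intro hhi
  have hform := log_form_lt (by omega) hhi
  have hpos : (n : ℝ) * Real.log 3 < ((n + b : ℕ) : ℝ) * Real.log 2 := by
    have h : (3 : ℝ) ^ n < 2 ^ (n + b) := by exact_mod_cast hlo
    have := Real.log_lt_log (by positivity) h
    rwa [Real.log_pow, Real.log_pow] at this
  generalize n + b = a at *
  have hl2 : 0 < Real.log 2 := Real.log_pos (by norm_num)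
  have hn0 : (60 : ℝ) ≤ n := by exact_mod_cast hn
  have hleft : 780239 * n < 492276 * a := by
    have : (780239 : ℝ) * n < 492276 * a := by
      refine lt_of_mul_lt_mul_right ?_ hl2.le
      nlinarith [log_three_gt]
    exact_mod_cast this
  have hright : 301994 * n ≤ 190537 * a := by omega
  have hright' : (301994 : ℝ) * n ≤ 190537 * a := by exact_mod_cast hright
  have h1 : (n : ℝ) * (1 / (2 ^ 24 + 1)) ≤ 190537 * (a * Real.log 2 - n * Real.log 3) := by
    nlinarith [log_three_lt, mul_le_mul_of_nonneg_right hright' hl2.le]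
  have h2 : (2 : ℝ) / 2 ^ n ≤ 2 / 2 ^ 60 := by
    gcongr
    norm_num
  norm_num at h1 h2
  linarith

/-! ### Integrals of Laurent polynomials -/

/-- The rational part of a primitive of `P(t) / t ^ (m + 1)`; the term of index `m`, whose primitive
is a logarithm, contributes zero. -/
noncomputable def laurentPrimitive (P : ℤ[X]) (m : ℕ) (t : ℝ) : ℝ :=
  ∑ i ∈ Finset.range (P.natDegree + 1), (P.coeff i : ℝ) * (t ^ ((i : ℤ) - m) / ((i : ℝ) - m))

theorem integral_laurent (P : ℤ[X]) {m : ℕ} (hm : m ≤ P.natDegree) {α β : ℝ} (hα : 0 < α)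
    (hβ : 0 < β) :
    ∫ t in α..β, aeval t P / t ^ (m + 1) =
      P.coeff m * Real.log (β / α) + (laurentPrimitive P m β - laurentPrimitive P m α) := by
  have h0 : (0 : ℝ) ∉ Set.uIcc α β := Set.notMem_uIcc_of_lt hα hβ
  have hne : ∀ t ∈ Set.uIcc α β, t ≠ 0 := fun t ht h => h0 (h ▸ ht)
  have hterm : ∀ i : ℕ, ∫ t in α..β, (P.coeff i : ℝ) * t ^ ((i : ℤ) - m - 1) =
      (if i = m then P.coeff m * Real.log (β / α) else 0) +
      ((P.coeff i : ℝ) * (β ^ ((i : ℤ) - m) / ((i : ℝ) - m)) -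
        (P.coeff i : ℝ) * (α ^ ((i : ℤ) - m) / ((i : ℝ) - m))) := by
    intro i
    rw [intervalIntegral.integral_const_mul]
    by_cases him : i = m
    · subst him
      simp [integral_inv h0, zpow_neg]
    · have : (i : ℤ) - m - 1 ≠ -1 := by omega
      rw [integral_zpow (Or.inr ⟨this, h0⟩), if_neg him]
      push_cast
      rw [sub_add_cancel, sub_add_cancel]
      ring
  have hint : ∫ t in α..β, aeval t P / t ^ (m + 1) = ∫ t in α..β,
      ∑ i ∈ Finset.range (P.natDegree + 1), (P.coeff i : ℝ) * t ^ ((i : ℤ) - m - 1) := by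
    refine intervalIntegral.integral_congr fun t ht => ?_
    have ht0 := hne t ht
    simp only [aeval_eq_sum_range, Finset.sum_div]
    refine Finset.sum_congr rfl fun i _ => ?_
    rw [sub_sub, zpow_sub₀ ht0, zsmul_eq_mul, mul_div_assoc]
    norm_cast
  rw [hint, intervalIntegral.integral_finsetSum]
  · rw [Finset.sum_congr rfl fun i _ => hterm i, Finset.sum_add_distrib, Finset.sum_sub_distrib,
      Finset.sum_ite_eq', if_pos (Finset.mem_range.2 (by omega))]
    rfl
  · intro i _
    refine ContinuousOn.intervalIntegrable fun t ht => ?_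
    exact ((continuousAt_zpow₀ t _ (Or.inl (hne t ht))).const_mul _).continuousWithinAt

/-- If `P(τ X)` is divisible by `τ ^ m`, the only denominators of `laurentPrimitive P m τ` are
those introduced by integration. -/
theorem exists_int_lcmUpto_mul_laurentPrimitive {P H : ℤ[X]} {m : ℕ} (hP : P.natDegree ≤ 2 * m + 1)
    {τ : ℕ} (hτ : τ ≠ 0) (hH : P.comp (C (τ : ℤ) * X) = C ((τ : ℤ) ^ m) * H) :
    ∃ z : ℤ, (Nat.lcmUpto (m + 1) : ℝ) * laurentPrimitive P m τ = z := by
  have hcoeff : ∀ i : ℕ, (P.coeff i : ℝ) * (τ : ℝ) ^ ((i : ℤ) - m) = H.coeff i := by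
    intro i
    have h := congrArg (fun Q : ℤ[X] => Q.coeff i) hH
    simp only [comp_C_mul_X_coeff, coeff_C_mul] at h
    have h' : (P.coeff i : ℝ) * (τ : ℝ) ^ i = (τ : ℝ) ^ m * H.coeff i := by exact_mod_cast h
    have hτ' : (τ : ℝ) ≠ 0 := by exact_mod_cast hτ
    rw [zpow_sub₀ hτ', zpow_natCast, zpow_natCast]
    field_simp
    linarith
  have hterm : ∀ i ∈ Finset.range (P.natDegree + 1), ∃ z : ℤ,
      (Nat.lcmUpto (m + 1) : ℝ) *
        ((P.coeff i : ℝ) * ((τ : ℝ) ^ ((i : ℤ) - m) / ((i : ℝ) - m))) = z := by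
    intro i hi
    rw [Finset.mem_range] at hi
    by_cases him : i = m
    · exact ⟨0, by simp [him]⟩
    have hne : ((i : ℤ) - m) ≠ 0 := by omega
    have hdvd : ((i : ℤ) - m) ∣ (Nat.lcmUpto (m + 1) : ℤ) := by
      rw [← Int.natAbs_dvd, Int.natCast_dvd_natCast]
      have h1 : 1 ≤ ((i : ℤ) - m).natAbs := by omega
      have h2 : ((i : ℤ) - m).natAbs ≤ m + 1 := by omega
      exact Finset.dvd_lcm (f := id) (Finset.mem_Icc.2 ⟨h1, h2⟩)
    obtain ⟨e, he⟩ := hdvd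
    have he' : (Nat.lcmUpto (m + 1) : ℝ) = ((i : ℝ) - m) * e := by exact_mod_cast he
    have hne' : ((i : ℝ) - m) ≠ 0 := by exact_mod_cast hne
    refine ⟨e * H.coeff i, ?_⟩
    rw [he', ← mul_div_assoc, hcoeff]
    push_cast
    field_simp
  choose! z hz using hterm
  refine ⟨∑ i ∈ Finset.range (P.natDegree + 1), z i, ?_⟩
  rw [laurentPrimitive, Finset.mul_sum, Finset.sum_congr rfl hz]
  push_cast
  rfl

/-! ### Coefficient majorants -/

/-- The coefficients of `P` are bounded in absolute value by those of `Q`. -/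
def CoeffLE (P Q : ℤ[X]) : Prop := ∀ i, |P.coeff i| ≤ Q.coeff i

theorem CoeffLE.mul {P Q P' Q' : ℤ[X]} (h : CoeffLE P Q) (h' : CoeffLE P' Q') :
    CoeffLE (P * P') (Q * Q') := by
  intro i
  rw [coeff_mul, coeff_mul]
  refine (Finset.abs_sum_le_sum_abs _ _).trans (Finset.sum_le_sum fun x _ => ?_)
  rw [abs_mul]
  exact mul_le_mul (h _) (h' _) (abs_nonneg _) ((abs_nonneg _).trans (h _))

theorem CoeffLE.pow {P Q : ℤ[X]} (h : CoeffLE P Q) (k : ℕ) : CoeffLE (P ^ k) (Q ^ k) := by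
  induction k with
  | zero =>
    intro i
    simp only [pow_zero, coeff_one]
    split_ifs <;> simp
  | succ k ih =>
    rw [pow_succ, pow_succ]
    exact ih.mul h

theorem coeffLE_X_sub_C {a : ℤ} (ha : 0 ≤ a) : CoeffLE (X - C a) (X + C a) := by
  intro i
  rw [coeff_sub, coeff_add]
  refine (abs_sub _ _).trans_eq ?_
  rw [coeff_X, coeff_C]
  split_ifs <;> simp [ha]

theorem CoeffLE.abs_coeff_mul_pow_le {P Q : ℤ[X]} (h : CoeffLE P Q) (m : ℕ) {t : ℤ} (ht : 0 ≤ t) :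
    |P.coeff m| * t ^ m ≤ Q.eval t := by
  have hQ : ∀ i, 0 ≤ Q.coeff i := fun i => (abs_nonneg _).trans (h i)
  refine (mul_le_mul_of_nonneg_right (h m) (by positivity)).trans ?_
  rw [eval_eq_sum_range]
  by_cases hm : m ∈ Finset.range (Q.natDegree + 1)
  · exact Finset.single_le_sum (f := fun i => Q.coeff i * t ^ i)
      (fun i _ => mul_nonneg (hQ i) (by positivity)) hm
  · rw [coeff_eq_zero_of_natDegree_lt (by simpa using hm), zero_mul]
    exact Finset.sum_nonneg fun i _ => mul_nonneg (hQ i) (by positivity)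

/-! ### The auxiliary polynomials -/

/-- The polynomial whose powers are small, relative to powers of `t ^ 10`, on `[8, 12]`. -/
noncomputable def auxBase : ℤ[X] :=
  (X - C 8) ^ 4 * (X - C 9) ^ 6 * (X - C 12) ^ 8 * (X - C 10) ^ 2

/-- The polynomials used to approximate `log (9 / 8)` and `log (4 / 3)` simultaneously. -/
noncomputable def auxPoly (k : ℕ) : ℤ[X] := (X - C 9) * auxBase ^ k

theorem natDegree_auxPoly (k : ℕ) : (auxPoly k).natDegree = 20 * k + 1 := by
  have h : ∀ (a : ℤ) (j : ℕ), ((X - C a) ^ j : ℤ[X]).Monic := fun a j => (monic_X_sub_C a).pow j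
  have hb : auxBase.Monic := (((h 8 4).mul (h 9 6)).mul (h 12 8)).mul (h 10 2)
  have hd : auxBase.natDegree = 20 := by
    rw [auxBase, Monic.natDegree_mul (((h 8 4).mul (h 9 6)).mul (h 12 8)) (h 10 2),
      Monic.natDegree_mul ((h 8 4).mul (h 9 6)) (h 12 8), Monic.natDegree_mul (h 8 4) (h 9 6)]
    simp only [natDegree_pow, natDegree_X_sub_C]
  rw [auxPoly, Monic.natDegree_mul (monic_X_sub_C 9) (hb.pow k), natDegree_pow, hd,
    natDegree_X_sub_C]
  ring

theorem aeval_auxPoly_div (k : ℕ) {t : ℝ} (ht : t ≠ 0) :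
    aeval t (auxPoly k) / t ^ (10 * k + 1) =
      (t - 9) / t * (((t - 8) ^ 2 * (t - 9) ^ 3 * (t - 12) ^ 4 * (t - 10) / t ^ 5) ^ 2) ^ k := by
  have h : aeval t auxBase = (t - 8) ^ 4 * (t - 9) ^ 6 * (t - 12) ^ 8 * (t - 10) ^ 2 := by
    simp [auxBase, map_ofNat]
  have h' : ((t - 8) ^ 2 * (t - 9) ^ 3 * (t - 12) ^ 4 * (t - 10) / t ^ 5) ^ 2 =
      ((t - 8) ^ 4 * (t - 9) ^ 6 * (t - 12) ^ 8 * (t - 10) ^ 2) / t ^ 10 := by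
    field_simp
  rw [auxPoly, map_mul, map_pow, h, h', div_pow, pow_succ t (10 * k), pow_mul t 10 k]
  simp only [map_sub, aeval_X, map_ofNat]
  field_simp

theorem exists_auxPoly_comp {τ : ℕ} (hτ : τ = 8 ∨ τ = 9 ∨ τ = 12) (k : ℕ) :
    ∃ H : ℤ[X], (auxPoly k).comp (C (τ : ℤ) * X) = C ((τ : ℤ) ^ (10 * k)) * H := by
  have hb : ∃ B : ℤ[X], auxBase.comp (C (τ : ℤ) * X) = C ((τ : ℤ) ^ 10) * B := by
    rcases hτ with rfl | rfl | rfl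
    · refine ⟨(X - 1) ^ 4 * (8 * X - 9) ^ 6 * (2 * X - 3) ^ 8 * (4 * X - 5) ^ 2, ?_⟩
      simp [auxBase]
      ring
    · refine ⟨(9 * X - 8) ^ 4 * (X - 1) ^ 6 * (3 * X - 4) ^ 8 * (9 * X - 10) ^ 2, ?_⟩
      simp [auxBase]
      ring
    · refine ⟨5184 * (3 * X - 2) ^ 4 * (4 * X - 3) ^ 6 * (X - 1) ^ 8 * (6 * X - 5) ^ 2, ?_⟩
      simp [auxBase]
      ring
  obtain ⟨B, hB⟩ := hb
  refine ⟨(X - C 9 : ℤ[X]).comp (C (τ : ℤ) * X) * B ^ k, ?_⟩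
  rw [auxPoly, mul_comp, pow_comp, hB, mul_pow, ← C_pow, ← pow_mul]
  ring

theorem abs_coeff_auxPoly_le (k : ℕ) : |(auxPoly k).coeff (10 * k)| ≤ 19 * (2 ^ 54) ^ k := by
  have hbase : CoeffLE auxBase
      ((X + C 8) ^ 4 * (X + C 9) ^ 6 * (X + C 12) ^ 8 * (X + C 10) ^ 2) :=
    ((((coeffLE_X_sub_C (by norm_num)).pow 4).mul ((coeffLE_X_sub_C (by norm_num)).pow 6)).mul
      ((coeffLE_X_sub_C (by norm_num)).pow 8)).mul ((coeffLE_X_sub_C (by norm_num)).pow 2)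
  have h := ((coeffLE_X_sub_C (show (0 : ℤ) ≤ 9 by norm_num)).mul
    (hbase.pow k)).abs_coeff_mul_pow_le (10 * k) (show (0 : ℤ) ≤ 10 by norm_num)
  simp only [eval_mul, eval_pow, eval_add, eval_X, eval_C] at h
  have h54 : ((10 + 8) ^ 4 * (10 + 9) ^ 6 * (10 + 12) ^ 8 * (10 + 10) ^ 2 : ℤ) ^ k ≤
      (2 ^ 54) ^ k * (10 ^ 10) ^ k := by
    rw [← mul_pow]
    exact pow_le_pow_left₀ (by norm_num) (by norm_num) k
  rw [pow_mul] at h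
  refine le_of_mul_le_mul_right (a := (10 ^ 10) ^ k) (h.trans ?_) (by positivity)
  rw [mul_assoc (19 : ℤ)]
  exact mul_le_mul (by norm_num) h54 (by positivity) (by norm_num)

/-! ### Size of the integrand -/

theorem grid_bound : ∀ i ∈ Finset.Ico 640 960,
    1800 * ((i + 1 - 640) ^ 2 * (max (i + 1 - 720) (720 - i)) ^ 3 * (960 - i) ^ 4 *
      max (i + 1 - 800) (800 - i)) ≤ 80 ^ 5 * i ^ 5 := by
  decide +kernel

theorem abs_pow_mul_le {x y z w a b c d : ℝ} (hx : |x| ≤ a) (hy : |y| ≤ b) (hz : |z| ≤ c)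
    (hw : |w| ≤ d) : |x ^ 2 * y ^ 3 * z ^ 4 * w| ≤ a ^ 2 * b ^ 3 * c ^ 4 * d := by
  have ha := (abs_nonneg x).trans hx
  have hb := (abs_nonneg y).trans hy
  have hc := (abs_nonneg z).trans hz
  simp only [abs_mul, abs_pow]
  gcongr

theorem abs_ratio_le {t : ℝ} (h8 : 8 ≤ t) (h12 : t ≤ 12) :
    |(t - 8) ^ 2 * (t - 9) ^ 3 * (t - 12) ^ 4 * (t - 10) / t ^ 5| ≤ 1 / 1800 := by
  rcases h12.eq_or_lt with rfl | h12
  · norm_num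
  obtain ⟨i, hi⟩ : ∃ i, i = ⌊80 * t⌋₊ := ⟨_, rfl⟩
  have hle : (i : ℝ) ≤ 80 * t := hi ▸ Nat.floor_le (by linarith)
  have hlt : 80 * t < i + 1 := hi ▸ Nat.lt_floor_add_one _
  have hi1 : 640 ≤ i := by
    rw [hi]
    exact Nat.le_floor (by push_cast; linarith)
  have hi2 : i < 960 := by
    rw [hi, Nat.floor_lt (by linarith)]
    push_cast
    linarith
  have hgrid := grid_bound i (Finset.mem_Ico.2 ⟨hi1, hi2⟩)
  have hnat : ∀ c : ℕ, |80 * t - c| ≤ (max (i + 1 - c) (c - i) : ℕ) := by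
    intro c
    rw [abs_le]
    rcases le_total c i with hc | hc
    · have : (c : ℝ) ≤ i := by exact_mod_cast hc
      rw [max_eq_left (by omega), Nat.cast_sub (by omega)]
      push_cast
      constructor <;> linarith
    · have h1 : ((c - i : ℕ) : ℝ) ≤ (max (i + 1 - c) (c - i) : ℕ) := by
        exact_mod_cast le_max_right _ _
      have h2 : ((i + 1 : ℕ) : ℝ) - c ≤ (max (i + 1 - c) (c - i) : ℕ) := by
        rw [sub_le_iff_le_add]
        exact_mod_cast (by omega)
      rw [Nat.cast_sub hc] at h1
      rw [Nat.cast_add, Nat.cast_one] at h2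
      constructor <;> linarith
  have hA := hnat 640
  have hB := hnat 720
  have hC := hnat 960
  have hD := hnat 800
  rw [max_eq_left (by omega)] at hA
  rw [max_eq_right (by omega)] at hC
  have hgrid' : (1800 : ℝ) * (((i + 1 - 640 : ℕ) : ℝ) ^ 2 *
      ((max (i + 1 - 720) (720 - i) : ℕ) : ℝ) ^ 3 * ((960 - i : ℕ) : ℝ) ^ 4 *
      ((max (i + 1 - 800) (800 - i) : ℕ) : ℝ)) ≤ 80 ^ 5 * (i : ℝ) ^ 5 := by exact_mod_cast hgrid
  have ht : 0 < t := by linarith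
  have hscale : (t - 8) ^ 2 * (t - 9) ^ 3 * (t - 12) ^ 4 * (t - 10) =
      ((80 * t - (640 : ℕ)) ^ 2 * (80 * t - (720 : ℕ)) ^ 3 * (80 * t - (960 : ℕ)) ^ 4 *
        (80 * t - (800 : ℕ))) / 80 ^ 10 := by
    push_cast
    ring
  have hprod : |(80 * t - (640 : ℕ)) ^ 2 * (80 * t - (720 : ℕ)) ^ 3 * (80 * t - (960 : ℕ)) ^ 4 *
        (80 * t - (800 : ℕ))| ≤ ((i + 1 - 640 : ℕ) : ℝ) ^ 2 *
      ((max (i + 1 - 720) (720 - i) : ℕ) : ℝ) ^ 3 * ((960 - i : ℕ) : ℝ) ^ 4 *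
      ((max (i + 1 - 800) (800 - i) : ℕ) : ℝ) := by
    exact abs_pow_mul_le hA hB hC hD
  have hpow : (i : ℝ) ^ 5 ≤ 80 ^ 5 * t ^ 5 := by
    rw [← mul_pow]
    gcongr
  rw [abs_div, abs_of_pos (pow_pos ht 5), div_le_div_iff₀ (pow_pos ht 5) (by norm_num), hscale,
    abs_div, abs_of_pos (show (0 : ℝ) < 80 ^ 10 by norm_num), div_mul_eq_mul_div,
    div_le_iff₀ (by norm_num)]
  linarith

/-- The integrand of the approximating integrals. -/
noncomputable def auxIntegrand (k : ℕ) (t : ℝ) : ℝ := aeval t (auxPoly k) / t ^ (10 * k + 1)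

theorem intervalIntegrable_auxIntegrand (k : ℕ) {α β : ℝ} (hα : 0 < α) (hβ : 0 < β) :
    IntervalIntegrable (auxIntegrand k) MeasureTheory.volume α β := by
  refine ContinuousOn.intervalIntegrable fun t ht => ?_
  have ht0 : t ≠ 0 := fun h => Set.notMem_uIcc_of_lt hα hβ (h ▸ ht)
  exact ((auxPoly k).continuous_aeval.continuousAt.div (continuousAt_id.pow _)
    (pow_ne_zero _ ht0)).continuousWithinAt

theorem abs_auxIntegrand_le (k : ℕ) {t : ℝ} (h8 : 8 ≤ t) (h12 : t ≤ 12) :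
    |auxIntegrand k t| ≤ (1 / 3240000) ^ k := by
  have ht : 0 < t := by linarith
  have h1 : |(t - 9) / t| ≤ 1 := by
    rw [abs_div, abs_of_pos ht, div_le_one ht, abs_le]
    constructor <;> linarith
  have h2 := pow_le_pow_left₀ (abs_nonneg _) (abs_ratio_le h8 h12) 2
  rw [← abs_pow] at h2
  rw [auxIntegrand, aeval_auxPoly_div k ht.ne', abs_mul, abs_pow]
  refine (mul_le_mul h1 (pow_le_pow_left₀ (abs_nonneg _) h2 k) (by positivity)
    zero_le_one).trans_eq ?_
  norm_num

theorem auxIntegrand_nonpos (k : ℕ) {t : ℝ} (h0 : 0 < t) (h9 : t ≤ 9) :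
    auxIntegrand k t ≤ 0 := by
  rw [auxIntegrand, aeval_auxPoly_div k h0.ne']
  exact mul_nonpos_of_nonpos_of_nonneg (div_nonpos_of_nonpos_of_nonneg (by linarith) h0.le)
    (by positivity)

theorem auxIntegrand_nonneg (k : ℕ) {t : ℝ} (h9 : 9 ≤ t) : 0 ≤ auxIntegrand k t := by
  rw [auxIntegrand, aeval_auxPoly_div k (by linarith)]
  exact mul_nonneg (div_nonneg (by linarith) (by linarith)) (by positivity)

theorem le_auxIntegrand (k : ℕ) {t : ℝ} (hl : 43 / 4 ≤ t) (hu : t ≤ 54 / 5) :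
    1 / 10 * (1 / 2 ^ 23) ^ k ≤ auxIntegrand k t := by
  have ht : 0 < t := by linarith
  rw [auxIntegrand, aeval_auxPoly_div k ht.ne']
  have h1 : 1 / 10 ≤ (t - 9) / t := by
    rw [div_le_div_iff₀ (by norm_num) ht]
    linarith
  have h2 : (1 : ℝ) / 2 ^ 23 ≤
      ((t - 8) ^ 2 * (t - 9) ^ 3 * (t - 12) ^ 4 * (t - 10) / t ^ 5) ^ 2 := by
    have h3 : (1 : ℝ) / 2896 ≤ (t - 8) ^ 2 * (t - 9) ^ 3 * (12 - t) ^ 4 * (t - 10) / t ^ 5 := by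
      calc (1 : ℝ) / 2896 ≤ (11 / 4) ^ 2 * (7 / 4) ^ 3 * (6 / 5) ^ 4 * (3 / 4) / (54 / 5) ^ 5 := by
            norm_num
        _ ≤ (t - 8) ^ 2 * (t - 9) ^ 3 * (12 - t) ^ 4 * (t - 10) / t ^ 5 := by
            have e1 : 11 / 4 ≤ t - 8 := by linarith
            have e2 : 7 / 4 ≤ t - 9 := by linarith
            have e3 : 6 / 5 ≤ 12 - t := by linarith
            have e4 : 3 / 4 ≤ t - 10 := by linarith
            have e5 : 0 ≤ t - 9 := by linarith
            gcongr
    have h4 : (12 - t) ^ 4 = (t - 12) ^ 4 := by ring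
    rw [h4] at h3
    refine le_trans ?_ (pow_le_pow_left₀ (by norm_num) h3 2)
    norm_num
  have h5 := pow_le_pow_left₀ (by norm_num) h2 k
  exact mul_le_mul h1 h5 (by positivity) (h1.trans' (by norm_num))

theorem integral_auxIntegrand_nonpos (k : ℕ) : ∫ t in (8 : ℝ)..9, auxIntegrand k t ≤ 0 := by
  rw [← neg_nonneg, ← intervalIntegral.integral_neg]
  exact intervalIntegral.integral_nonneg (by norm_num) fun t ht =>
    neg_nonneg.2 (auxIntegrand_nonpos k (by linarith [ht.1]) ht.2)

theorem abs_integral_auxIntegrand_le (k : ℕ) {α β : ℝ} (h8 : 8 ≤ α) (h : α ≤ β) (h12 : β ≤ 12) :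
    |∫ t in α..β, auxIntegrand k t| ≤ (1 / 3240000) ^ k * (β - α) := by
  rw [← abs_of_nonneg (sub_nonneg.2 h), ← Real.norm_eq_abs]
  refine intervalIntegral.norm_integral_le_of_norm_le_const fun t ht => ?_
  rw [Set.uIoc_of_le h] at ht
  exact abs_auxIntegrand_le k (by linarith [ht.1]) (by linarith [ht.2])

theorem le_integral_auxIntegrand (k : ℕ) :
    1 / 200 * (1 / 2 ^ 23) ^ k ≤ ∫ t in (9 : ℝ)..12, auxIntegrand k t := by
  calc (1 : ℝ) / 200 * (1 / 2 ^ 23) ^ k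
      = ∫ _ in (43 / 4 : ℝ)..(54 / 5), (1 : ℝ) / 10 * (1 / 2 ^ 23) ^ k := by
        rw [intervalIntegral.integral_const, smul_eq_mul]
        ring
    _ ≤ ∫ t in (43 / 4 : ℝ)..(54 / 5), auxIntegrand k t :=
        intervalIntegral.integral_mono_on (by norm_num) intervalIntegrable_const
          (intervalIntegrable_auxIntegrand k (by norm_num) (by norm_num))
          fun t ht => le_auxIntegrand k ht.1 ht.2
    _ ≤ ∫ t in (9 : ℝ)..12, auxIntegrand k t := by
        refine intervalIntegral.integral_mono_interval (by norm_num) (by norm_num) (by norm_num)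
          ?_ (intervalIntegrable_auxIntegrand k (by norm_num) (by norm_num))
        filter_upwards [MeasureTheory.ae_restrict_mem measurableSet_Ioc] with t ht
        exact auxIntegrand_nonneg k ht.1.le

/-! ### Denominators against decay -/

theorem log_le_mul_sqrt {x : ℝ} (hx : 65536 ≤ x) : Real.log x ≤ 0.0434 * √x := by
  have hs : √(65536 : ℝ) = 256 := by
    rw [show (65536 : ℝ) = 256 ^ 2 by norm_num, Real.sqrt_sq (by norm_num)]
  have he : Real.exp 2 ≤ 65536 := by
    have h := Real.exp_one_lt_d9
    rw [show (2 : ℝ) = 1 + 1 by norm_num, Real.exp_add]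
    nlinarith [Real.exp_pos 1]
  have h := Real.log_div_sqrt_antitoneOn (Set.mem_Ici.2 he) (Set.mem_Ici.2 (he.trans hx)) hx
  have hl : Real.log 65536 = 16 * Real.log 2 := by
    rw [show (65536 : ℝ) = 2 ^ 16 by norm_num, Real.log_pow]
    norm_num
  simp only [hs, hl] at h
  rw [div_le_iff₀ (Real.sqrt_pos.2 (by linarith))] at h
  refine h.trans ?_
  gcongr
  linarith [Real.log_two_lt_d9]

theorem lcmUpto_mul_lt {k : ℕ} (hk : 6554 ≤ k) :
    80 * ((10 * k + 1 : ℕ) : ℝ) * Nat.lcmUpto (10 * k + 1) * (1 / 3240000) ^ k < 1 := by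
  have hk' : (6554 : ℝ) ≤ k := by exact_mod_cast hk
  have hψ := Chebyshev.psi_le (x := ((10 * k + 1 : ℕ) : ℝ)) (by push_cast; linarith)
  rw [Chebyshev.psi_eq_log_lcmUpto] at hψ
  have hd : (0 : ℝ) < Nat.lcmUpto (10 * k + 1) := by exact_mod_cast Nat.lcmUpto_pos _
  set d : ℝ := ((Nat.lcmUpto (10 * k + 1) : ℕ) : ℝ)
  have hx : ((10 * k + 1 : ℕ) : ℝ) = 10 * k + 1 := by push_cast; ring
  rw [hx] at hψ ⊢
  set x : ℝ := 10 * k + 1 with hxdef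
  have hx0 : 65536 ≤ x := by linarith
  have hlog := log_le_mul_sqrt hx0
  have hsq : √x * √x = x := Real.mul_self_sqrt (by linarith)
  have hs1 : 256 ≤ √x := Real.le_sqrt_of_sq_le (by linarith)
  have hlog1 : 2 * √x * Real.log x ≤ 0.0868 * x := by nlinarith
  have hlog2 : Real.log x ≤ 0.0002 * x := by nlinarith
  have h80 : Real.log 80 ≤ 80 - 1 := Real.log_le_sub_one_of_pos (by norm_num)
  have h4 : Real.log 4 ≤ 4 - 1 := Real.log_le_sub_one_of_pos (by norm_num)
  have hgap : 1 + 10 * Real.log 4 ≤ Real.log 3240000 := by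
    have h1 : (1 : ℝ) ≤ Real.log 3 := by
      rw [Real.le_log_iff_exp_le (by norm_num)]
      linarith [Real.exp_one_lt_d9]
    have h2 : Real.log (3 * 4 ^ 10) ≤ Real.log 3240000 :=
      Real.log_le_log (by norm_num) (by norm_num)
    rw [Real.log_mul (by norm_num) (by norm_num), Real.log_pow] at h2
    push_cast at h2
    linarith
  have hmain : Real.log (80 * x * d) < k * Real.log 3240000 := by
    rw [Real.log_mul (by positivity) hd.ne', Real.log_mul (by norm_num) (by positivity)]
    have := mul_le_mul_of_nonneg_left hgap (show (0 : ℝ) ≤ k by positivity)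
    nlinarith
  rw [← Real.log_pow, Real.log_lt_log_iff (by positivity) (by positivity)] at hmain
  rw [one_div, inv_pow, ← div_eq_mul_inv, div_lt_one (by positivity)]
  exact hmain

/-! ### Large exponents -/

theorem not_near_power_of_ge {n b : ℕ} (hn : 511212 ≤ n) (hlo : 3 ^ n < 2 ^ (n + b)) :
    ¬ 2 ^ (n + b) < 3 ^ n + 2 ^ b := by
  intro hhi
  have hbn : b < n := lt_of_near_power (by omega) hhi
  have hnb : n < 2 * b := by
    have h1 : (2 : ℕ) ^ (3 * n) < 2 ^ (2 * (n + b)) := by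
      calc (2 : ℕ) ^ (3 * n) = 8 ^ n := by rw [pow_mul]; norm_num
        _ ≤ 9 ^ n := Nat.pow_le_pow_left (by norm_num) n
        _ = (3 ^ n) ^ 2 := by rw [← pow_mul, mul_comm, pow_mul]; norm_num
        _ < (2 ^ (n + b)) ^ 2 := Nat.pow_lt_pow_left hlo (by norm_num)
        _ = 2 ^ (2 * (n + b)) := by rw [← pow_mul, mul_comm]
    have h2 := (Nat.pow_lt_pow_iff_right (by norm_num)).1 h1
    omega
  obtain ⟨k, hk⟩ : ∃ k, k = n / 78 := ⟨_, rfl⟩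
  have hk0 : 6554 ≤ k := by omega
  have hkn : 78 * k ≤ n := by omega
  have hnk : n ≤ 10 * (10 * k + 1) := by omega
  have hform := log_form_lt (by omega) hhi
  have hformpos : 0 < ((n + b : ℕ) : ℝ) * Real.log 2 - n * Real.log 3 := by
    have h : (3 : ℝ) ^ n < 2 ^ (n + b) := by exact_mod_cast hlo
    have := Real.log_lt_log (by positivity) h
    rw [Real.log_pow, Real.log_pow] at this
    linarith
  set Λ : ℝ := ((n + b : ℕ) : ℝ) * Real.log 2 - n * Real.log 3 with hΛ
  have hbn' : (b : ℝ) ≤ n := by exact_mod_cast hbn.le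
  have hnb' : (n : ℝ) + 1 ≤ 2 * b := by exact_mod_cast hnb
  have hl98 : Real.log (9 / 8) = 2 * Real.log 3 - 3 * Real.log 2 := by
    rw [Real.log_div (by norm_num) (by norm_num), show (9 : ℝ) = 3 ^ 2 by norm_num,
      show (8 : ℝ) = 2 ^ 3 by norm_num, Real.log_pow, Real.log_pow]
    norm_num
  have hl129 : Real.log (12 / 9) = 2 * Real.log 2 - Real.log 3 := by
    rw [show (12 / 9 : ℝ) = 2 ^ 2 / 3 by norm_num, Real.log_div (by norm_num) (by norm_num),
      Real.log_pow]
    norm_num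
  have hdeg := natDegree_auxPoly k
  have hI₁ := integral_laurent (auxPoly k) (m := 10 * k) (by omega) (show (0 : ℝ) < 8 by norm_num)
    (show (0 : ℝ) < 9 by norm_num)
  have hI₂ := integral_laurent (auxPoly k) (m := 10 * k) (by omega) (show (0 : ℝ) < 9 by norm_num)
    (show (0 : ℝ) < 12 by norm_num)
  have hint : ∀ τ : ℕ, τ = 8 ∨ τ = 9 ∨ τ = 12 → ∃ z : ℤ,
      (Nat.lcmUpto (10 * k + 1) : ℝ) * laurentPrimitive (auxPoly k) (10 * k) τ = z := by
    intro τ hτ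
    obtain ⟨H, hH⟩ := exists_auxPoly_comp hτ k
    exact exists_int_lcmUpto_mul_laurentPrimitive (by omega) (by omega) hH
  obtain ⟨z₈, hz₈⟩ := hint 8 (by simp)
  obtain ⟨z₉, hz₉⟩ := hint 9 (by simp)
  obtain ⟨z₁₂, hz₁₂⟩ := hint 12 (by simp)
  push_cast at hz₈ hz₉ hz₁₂
  have hI₁' := integral_auxIntegrand_nonpos k
  have hI₁'' := neg_le_of_abs_le
    (abs_integral_auxIntegrand_le k (show (8 : ℝ) ≤ 8 by norm_num) (show (8 : ℝ) ≤ 9 by norm_num)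
      (by norm_num))
  have hI₂' := le_integral_auxIntegrand k
  have hI₂'' := le_of_abs_le
    (abs_integral_auxIntegrand_le k (show (8 : ℝ) ≤ 9 by norm_num) (show (9 : ℝ) ≤ 12 by norm_num)
      (by norm_num))
  simp only [auxIntegrand] at hI₁' hI₁'' hI₂' hI₂''
  have hr : |((auxPoly k).coeff (10 * k) : ℝ)| ≤ 19 * (2 ^ 54) ^ k := by
    exact_mod_cast abs_coeff_auxPoly_le k
  have hsize := lcmUpto_mul_lt hk0
  have hd : (0 : ℝ) < Nat.lcmUpto (10 * k + 1) := by exact_mod_cast Nat.lcmUpto_pos _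
  generalize (∫ t in (8 : ℝ)..9, aeval t (auxPoly k) / t ^ (10 * k + 1)) = I₁ at *
  generalize (∫ t in (9 : ℝ)..12, aeval t (auxPoly k) / t ^ (10 * k + 1)) = I₂ at *
  generalize laurentPrimitive (auxPoly k) (10 * k) 8 = F₈ at *
  generalize laurentPrimitive (auxPoly k) (10 * k) 9 = F₉ at *
  generalize laurentPrimitive (auxPoly k) (10 * k) 12 = F₁₂ at *
  generalize ((auxPoly k).coeff (10 * k) : ℝ) = r at *
  generalize (Nat.lcmUpto (10 * k + 1) : ℝ) = d at *
  obtain ⟨J, hJ⟩ : ∃ J : ℝ, J = (2 * b - n) * I₂ - (n - b) * I₁ := ⟨_, rfl⟩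
  obtain ⟨z, hz⟩ : ∃ z : ℤ, d * (J - r * Λ) = z := by
    refine ⟨(2 * b - n) * (z₁₂ - z₉) - (n - b) * (z₉ - z₈), ?_⟩
    push_cast
    rw [← hz₈, ← hz₉, ← hz₁₂, hJ, hI₁, hI₂, hl98, hl129, hΛ]
    push_cast
    ring
  have hJlow : 1 / 200 * (1 / 2 ^ 23) ^ k ≤ J := by
    have h1 : 0 ≤ (n - b) * -I₁ := mul_nonneg (by linarith) (by linarith)
    have h2 : (0 : ℝ) ≤ (1 / 2 ^ 23) ^ k := by positivity
    have h3 : 0 ≤ I₂ := by linarith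
    nlinarith
  have hJup : J ≤ 4 * n * (1 / 3240000) ^ k := by
    have h0 : (0 : ℝ) ≤ (1 / 3240000) ^ k := by positivity
    generalize ((1 : ℝ) / 3240000) ^ k = ε at *
    have h1 : (n - b) * -I₁ ≤ (n - b) * ε := mul_le_mul_of_nonneg_left (by linarith) (by linarith)
    have h2 : (2 * b - n) * I₂ ≤ (2 * b - n) * (ε * 3) :=
      mul_le_mul_of_nonneg_left (by linarith) (by linarith)
    nlinarith
  have hrΛ : |r * Λ| < J := by
    refine lt_of_lt_of_le ?_ hJlow
    rw [abs_mul, abs_of_pos hformpos]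
    have h1 : Λ < 2 / 2 ^ (78 * k) :=
      hform.trans_le (by gcongr; norm_num)
    have h2 : (7600 : ℝ) < 2 ^ k := by
      calc (7600 : ℝ) < 2 ^ 13 := by norm_num
        _ ≤ 2 ^ k := pow_le_pow_right₀ (by norm_num) (by omega)
    calc |r| * Λ ≤ 19 * (2 ^ 54) ^ k * (2 / 2 ^ (78 * k)) :=
          mul_le_mul hr h1.le hformpos.le (by positivity)
      _ = 7600 * (1 / 200 * ((2 ^ 54) ^ k / 2 ^ (78 * k))) := by ring
      _ < 2 ^ k * (1 / 200 * ((2 ^ 54) ^ k / 2 ^ (78 * k))) := by gcongr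
      _ = 1 / 200 * (1 / 2 ^ 23) ^ k := by
          have h3 : (2 : ℝ) ^ (78 * k) = 2 ^ k * (2 ^ 54) ^ k * (2 ^ 23) ^ k := by
            rw [← pow_mul, ← pow_mul, ← pow_add, ← pow_add]
            congr 1
            ring
          rw [h3, div_pow, one_pow]
          field_simp
  rw [abs_lt] at hrΛ
  have hzpos : (0 : ℝ) < z := by
    rw [← hz]
    exact mul_pos hd (by linarith)
  have hzlt : (z : ℝ) < 1 := by
    have hnk' : (n : ℝ) ≤ 10 * (10 * k + 1 : ℕ) := by exact_mod_cast hnk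
    calc (z : ℝ) = d * (J - r * Λ) := hz.symm
      _ ≤ d * (2 * (4 * n * (1 / 3240000) ^ k)) := by
          gcongr
          linarith
      _ = 8 * n * d * (1 / 3240000) ^ k := by ring
      _ ≤ 8 * (10 * (10 * k + 1 : ℕ)) * d * (1 / 3240000) ^ k := by gcongr
      _ = 80 * (10 * k + 1 : ℕ) * d * (1 / 3240000) ^ k := by ring
      _ < 1 := hsize
  have h0 : 0 < z := by exact_mod_cast hzpos
  have h1 : z < 1 := by exact_mod_cast hzlt
  omega

/-- A power of two `2 ^ (n + b)` with `n ≥ 2` does not lie strictly between `3 ^ n` and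
`3 ^ n + 2 ^ b`. -/
theorem not_near_power {n b : ℕ} (hn : 2 ≤ n) (hlo : 3 ^ n < 2 ^ (n + b)) :
    ¬ 2 ^ (n + b) < 3 ^ n + 2 ^ b := by
  intro hhi
  rcases lt_or_ge n 60 with h | h
  · exact not_near_power_of_lt_sixty n h hn b (lt_of_near_power hn hhi) hlo hhi
  rcases lt_or_ge n 682813 with h' | h'
  · exact not_near_power_of_lt h h' hlo hhi
  · exact not_near_power_of_ge (by omega) hlo hhi

theorem stmt_14 (D b n k : ℕ) (hD : 0 < D) (hb : 0 < b) (hn : 0 < n)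
    (hk : 0 < k) (hkodd : Odd k)
    (h1 : D = 2 ^ n * k - 1) (h2 : 2 ^ b * D = 3 ^ n * k - 1) :
    D = 1 ∧ b = 1 ∧ n = 1 ∧ k = 1 := by
  have h2n : 1 ≤ 2 ^ n * k := Nat.mul_pos (by positivity) hk
  have h3n : 1 ≤ 3 ^ n * k := Nat.mul_pos (by positivity) hk
  have h2b : 2 ≤ 2 ^ b := Nat.le_self_pow hb.ne' 2
  have hkey : 2 ^ (n + b) * k + 1 = 3 ^ n * k + 2 ^ b := by
    have h1' : D + 1 = 2 ^ n * k := by omega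
    have h2' : 2 ^ b * D + 1 = 3 ^ n * k := by omega
    calc 2 ^ (n + b) * k + 1 = 2 ^ b * (2 ^ n * k) + 1 := by ring
      _ = 3 ^ n * k + 2 ^ b := by rw [← h1', ← h2']; ring
  have hlo : 3 ^ n < 2 ^ (n + b) := by
    by_contra! h
    have := Nat.mul_le_mul_right k h
    omega
  have hhi : 2 ^ (n + b) < 3 ^ n + 2 ^ b := by
    by_contra! h
    have := Nat.mul_le_mul_right k h
    nlinarith [Nat.mul_le_mul_left (2 ^ b) hk]
  have hn1 : n = 1 := by
    by_contra h
    exact not_near_power (by omega) hlo hhi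
  subst hn1
  have hb1 : b = 1 := by
    by_contra h
    have : 2 ^ 2 ≤ 2 ^ b := Nat.pow_le_pow_right (by norm_num) (by omega)
    rw [pow_add] at hhi
    omega
  subst hb1
  omega
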